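/- arXiv:2010.04223 — 2 statements merged into one kernel-verified Lean document; each statement's English description precedes it below -/
import Mathlib

section
/- In the model-based fictitious play under Assumption 1, for every state s ∈ S and each λ > 1 with γλ < 1: lim_{k→∞} max(v̂_{1,k}(s) + v̂_{2,k}(s) − λ ‖Q̂_{1,s,k} + Q̂_{2,s,k}‖_max, 0) = 0. -/
open Finset Filter Topology

/-- Model-based fictitious play in a finite two-player zero-sum stochastic game. -/
structure MBFP (S A1 A2 : Type) [Fintype S] [Fintype A1] [Fintype A2]
    [Nonempty S] [Nonempty A1] [Nonempty A2]
    [DecidableEq S] [DecidableEq A1] [DecidableEq A2] where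
  /-- stage payoff of player 1 -/
  r1 : S → A1 → A2 → ℝ
  /-- stage payoff of player 2 -/
  r2 : S → A1 → A2 → ℝ
  /-- transition probabilities: `p s a b s'` is the probability of moving to `s'` -/
  p : S → A1 → A2 → S → ℝ
  /-- discount factor -/
  γ : ℝ
  zerosum : ∀ s a b, r1 s a b + r2 s a b = 0
  p_nonneg : ∀ s a b s', 0 ≤ p s a b s'
  p_sum_one : ∀ s a b, ∑ s', p s a b s' = 1
  γ_nonneg : 0 ≤ γ
  γ_lt_one : γ < 1
  /-- the realized state sequence -/
  st : ℕ → S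
  /-- step sizes for beliefs on strategies -/
  α : ℕ → ℝ
  /-- step sizes for beliefs on Q-functions -/
  β : ℕ → ℝ
  α_mem : ∀ c, α c ∈ Set.Ioc (0:ℝ) 1
  β_mem : ∀ c, β c ∈ Set.Ioc (0:ℝ) 1
  /-- belief (held by player 2) on player 1's mixed action at each state -/
  π1 : S → ℕ → A1 → ℝ
  /-- belief (held by player 1) on player 2's mixed action at each state -/
  π2 : S → ℕ → A2 → ℝ
  /-- player 1's belief on its own Q-function -/
  Q1 : S → ℕ → A1 → A2 → ℝ
  /-- player 2's belief on its own Q-function -/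
  Q2 : S → ℕ → A1 → A2 → ℝ
  /-- best-response action of player 1 at stage k -/
  astar1 : ℕ → A1
  /-- best-response action of player 2 at stage k -/
  astar2 : ℕ → A2
  π1_simplex : ∀ s k, π1 s k ∈ stdSimplex ℝ A1
  π2_simplex : ∀ s k, π2 s k ∈ stdSimplex ℝ A2
  Q1_init : ∀ s, Q1 s 0 = r1 s
  Q2_init : ∀ s, Q2 s 0 = r2 s
  astar1_br : ∀ k b,
    ∑ b2, Q1 (st k) k b b2 * π2 (st k) k b2
      ≤ ∑ b2, Q1 (st k) k (astar1 k) b2 * π2 (st k) k b2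
  astar2_br : ∀ k b,
    ∑ b1, π1 (st k) k b1 * Q2 (st k) k b1 b
      ≤ ∑ b1, π1 (st k) k b1 * Q2 (st k) k b1 (astar2 k)
  π1_upd : ∀ s k, π1 s (k+1) = fun b =>
    π1 s k b + (if s = st k then α (((Finset.range k).filter fun k' => st k' = s).card) else 0)
      * ((if b = astar1 k then (1:ℝ) else 0) - π1 s k b)
  π2_upd : ∀ s k, π2 s (k+1) = fun b =>
    π2 s k b + (if s = st k then α (((Finset.range k).filter fun k' => st k' = s).card) else 0)
      * ((if b = astar2 k then (1:ℝ) else 0) - π2 s k b)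
  Q1_upd : ∀ s k, Q1 s (k+1) = fun b1 b2 =>
    Q1 s k b1 b2
      + (if s = st k then β (((Finset.range k).filter fun k' => st k' = s).card) else 0)
        * (r1 s b1 b2
          + γ * ∑ s', (Finset.univ.sup' Finset.univ_nonempty fun c1 =>
              ∑ b2', Q1 s' k c1 b2' * π2 s' k b2') * p s b1 b2 s'
          - Q1 s k b1 b2)
  Q2_upd : ∀ s k, Q2 s (k+1) = fun b1 b2 =>
    Q2 s k b1 b2
      + (if s = st k then β (((Finset.range k).filter fun k' => st k' = s).card) else 0)
        * (r2 s b1 b2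
          + γ * ∑ s', (Finset.univ.sup' Finset.univ_nonempty fun c2 =>
              ∑ b1', π1 s' k b1' * Q2 s' k b1' c2) * p s b1 b2 s'
          - Q2 s k b1 b2)

variable {S A1 A2 : Type} [Fintype S] [Fintype A1] [Fintype A2]
    [Nonempty S] [Nonempty A1] [Nonempty A2]
    [DecidableEq S] [DecidableEq A1] [DecidableEq A2]

/-- the largest absolute value of an entry of a matrix -/
noncomputable def maxNorm (Q : A1 → A2 → ℝ) : ℝ :=
  Finset.univ.sup' Finset.univ_nonempty fun q : A1 × A2 => |Q q.1 q.2|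

namespace MBFP

/-- the number of visits to state `s` before stage `k` -/
def cnt (G : MBFP S A1 A2) (s : S) (k : ℕ) : ℕ :=
  ((Finset.range k).filter fun k' => G.st k' = s).card

/-- player 1's estimate of its continuation payoff at state `s` -/
noncomputable def vhat1 (G : MBFP S A1 A2) (k : ℕ) (s : S) : ℝ :=
  Finset.univ.sup' Finset.univ_nonempty fun b1 => ∑ b2, G.Q1 s k b1 b2 * G.π2 s k b2

/-- player 2's estimate of its continuation payoff at state `s` -/
noncomputable def vhat2 (G : MBFP S A1 A2) (k : ℕ) (s : S) : ℝ :=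
  Finset.univ.sup' Finset.univ_nonempty fun b2 => ∑ b1, G.π1 s k b1 * G.Q2 s k b1 b2

/-- Assumption 1 of the paper -/
def Assumption1 (G : MBFP S A1 A2) : Prop :=
  (∀ s, Tendsto (fun k => G.cnt s k) atTop atTop) ∧
  Tendsto (fun n => ∑ c ∈ Finset.range n, G.α c) atTop atTop ∧
  Tendsto (fun n => ∑ c ∈ Finset.range n, G.β c) atTop atTop ∧
  Tendsto G.α atTop (𝓝 0) ∧
  Tendsto G.β atTop (𝓝 0) ∧
  Tendsto (fun c => G.β c / G.α c) atTop (𝓝 0)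

end MBFP

/-- One side of a perturbed fictitious play with payoff matrix `Q` over the stages `s, …, t`:
`a k` maximizes the cumulative payoff vector `u k`, and `u` grows by `w k` times the column of `Q`
picked by the opponent's action `b k`, up to an error `w k * η`. -/
structure IsResponse {I J : Type} (B η : ℝ) (Q : I → J → ℝ) (w : ℕ → ℝ) (s t : ℕ)
    (u : ℕ → I → ℝ) (a : ℕ → I) (b : ℕ → J) : Prop where
  le_max : ∀ k, s ≤ k → k ≤ t → ∀ i, u k i ≤ u k (a k)
  step : ∀ k, s ≤ k → k < t → ∀ i, |u (k + 1) i - u k i - w k * Q i (b k)| ≤ w k * η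
  bound : ∀ k, s ≤ k → k < t → ∀ i, |u (k + 1) i - u k i| ≤ w k * B

namespace IsResponse

variable {I J : Type} {B η : ℝ} {Q : I → J → ℝ} {w : ℕ → ℝ} {s t : ℕ}
  {u : ℕ → I → ℝ} {a : ℕ → I} {b : ℕ → J}

lemma mono (h : IsResponse B η Q w s t u a b) {s' t' : ℕ} (hs : s ≤ s') (ht : t' ≤ t) :
    IsResponse B η Q w s' t' u a b :=
  ⟨fun k h1 h2 => h.le_max k (hs.trans h1) (h2.trans ht),
   fun k h1 h2 => h.step k (hs.trans h1) (h2.trans_le ht),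
   fun k h1 h2 => h.bound k (hs.trans h1) (h2.trans_le ht)⟩

lemma abs_sub_le (h : IsResponse B η Q w s t u a b) (hst : s ≤ t) (i : I) :
    |u t i - u s i| ≤ (∑ k ∈ Finset.Ico s t, w k) * B := by
  induction t, hst using Nat.le_induction with
  | base => simp
  | succ t hst ih =>
    rw [Finset.sum_Ico_succ_top hst]
    have h1 := ih (h.mono le_rfl (Nat.le_succ t))
    have h2 := h.bound t hst (Nat.lt_succ_self t) i
    rw [abs_le] at *
    constructor <;> linarith

lemma le_add_sum (h : IsResponse B η Q w s t u a b) (hst : s ≤ t) (i : I) :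
    u t i ≤ u s i + ∑ k ∈ Finset.Ico s t, w k * (Q i (b k) + η) := by
  induction t, hst using Nat.le_induction with
  | base => simp
  | succ t hst ih =>
    rw [Finset.sum_Ico_succ_top hst]
    have h1 := ih (h.mono le_rfl (Nat.le_succ t))
    have h2 := (abs_le.1 (h.step t hst (Nat.lt_succ_self t) i)).2
    linarith

lemma max_sub_le (h : IsResponse B η Q w s t u a b) (hst : s ≤ t) :
    u t (a t) - u s (a s) ≤ (∑ k ∈ Finset.Ico s t, w k) * B := by
  have h1 := (abs_le.1 (h.abs_sub_le hst (a t))).2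
  have h2 := h.le_max s le_rfl hst (a t)
  linarith

/-- A row that is optimal at some stage of a window is nearly optimal at the end of the window. -/
lemma near_max (h : IsResponse B η Q w s t u a b) (hw : ∀ k, s ≤ k → k < t → 0 ≤ w k)
    (hB : 0 ≤ B) {i : I} {k : ℕ} (hsk : s ≤ k) (hkt : k ≤ t) (hi : ∀ i', u k i' ≤ u k i) :
    u t (a t) - 2 * B * (∑ k ∈ Finset.Ico s t, w k) ≤ u t i := by
  have h' := h.mono hsk le_rfl
  have h1 := (abs_le.1 (h'.abs_sub_le hkt (a t))).2
  have h2 := (abs_le.1 (h'.abs_sub_le hkt i)).1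
  have h3 := hi (a t)
  have h4 : ∑ k ∈ Finset.Ico k t, w k ≤ ∑ k ∈ Finset.Ico s t, w k := by
    apply Finset.sum_le_sum_of_subset_of_nonneg
    · exact Finset.Ico_subset_Ico hsk le_rfl
    · intro j hj _
      rw [Finset.mem_Ico] at hj
      exact hw j hj.1 hj.2
  have h5 := mul_le_mul_of_nonneg_right h4 hB
  linarith

end IsResponse

open Classical in
/-- The actions that are optimal against `u` at some stage in `s, …, t`. -/
noncomputable def eligible {I : Type} [Fintype I] (u : ℕ → I → ℝ) (s t : ℕ) : Finset I :=
  Finset.univ.filter fun i => ∃ k, s ≤ k ∧ k ≤ t ∧ ∀ i', u k i' ≤ u k i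

lemma mem_eligible {I : Type} [Fintype I] {u : ℕ → I → ℝ} {s t : ℕ} {i : I} :
    i ∈ eligible u s t ↔ ∃ k, s ≤ k ∧ k ≤ t ∧ ∀ i', u k i' ≤ u k i := by
  simp [eligible]

lemma eligible_mono {I : Type} [Fintype I] (u : ℕ → I → ℝ) {s t s' t' : ℕ}
    (hs : s ≤ s') (ht : t' ≤ t) : eligible u s' t' ⊆ eligible u s t := by
  intro i hi
  rw [mem_eligible] at *
  obtain ⟨k, h1, h2, h3⟩ := hi
  exact ⟨k, hs.trans h1, h2.trans ht, h3⟩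

/-- If every action played in `s, …, t` is nearly optimal at stage `t`, then the sum of the two
maximal payoffs grows at most at the rate given by the entries of `Q₁ + Q₂`. -/
lemma growth_le_of_near_max {I J : Type} {B η N D : ℝ} {Q₁ : I → J → ℝ} {Q₂ : J → I → ℝ}
    {w : ℕ → ℝ} {s t : ℕ} {u : ℕ → I → ℝ} {v : ℕ → J → ℝ} {a : ℕ → I} {b : ℕ → J}
    (hu : IsResponse B η Q₁ w s t u a b) (hv : IsResponse B η Q₂ w s t v b a)
    (hw : ∀ k, s ≤ k → k < t → 0 ≤ w k) (hN : ∀ i j, Q₁ i j + Q₂ j i ≤ N) (hst : s ≤ t)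
    (hpos : 0 < ∑ k ∈ Finset.Ico s t, w k)
    (hua : ∀ k, s ≤ k → k < t → u t (a t) - D ≤ u t (a k))
    (hvb : ∀ k, s ≤ k → k < t → v t (b t) - D ≤ v t (b k)) :
    u t (a t) + v t (b t) - (u s (a s) + v s (b s))
      ≤ (N + 2 * η) * (∑ k ∈ Finset.Ico s t, w k) + 2 * D := by
  set τ := ∑ k ∈ Finset.Ico s t, w k with hτ
  have key : ∀ {I J : Type} {Q : I → J → ℝ} {u : ℕ → I → ℝ} {a : ℕ → I} {b : ℕ → J},
      IsResponse B η Q w s t u a b → (∀ k, s ≤ k → k < t → u t (a t) - D ≤ u t (a k)) →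
      τ * (u t (a t) - D) ≤ τ * u s (a s) +
        ∑ k ∈ Finset.Ico s t, ∑ l ∈ Finset.Ico s t, w k * w l * (Q (a k) (b l) + η) := by
    intro I J Q u a b h hD
    rw [hτ, Finset.sum_mul, Finset.sum_mul, ← Finset.sum_add_distrib]
    apply Finset.sum_le_sum
    intro k hk
    rw [Finset.mem_Ico] at hk
    have h1 := h.le_add_sum hst (a k)
    have h2 := hD k hk.1 hk.2
    have h3 := h.le_max s le_rfl hst (a k)
    have h4 : ∑ l ∈ Finset.Ico s t, w k * w l * (Q (a k) (b l) + η)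
        = w k * ∑ l ∈ Finset.Ico s t, w l * (Q (a k) (b l) + η) := by
      rw [Finset.mul_sum]
      exact Finset.sum_congr rfl fun l _ => by ring
    rw [h4, ← mul_add]
    exact mul_le_mul_of_nonneg_left (by linarith) (hw k hk.1 hk.2)
  have h1 := key hu hua
  have h2 := key hv hvb
  rw [Finset.sum_comm] at h2
  have h3 : (∑ k ∈ Finset.Ico s t, ∑ l ∈ Finset.Ico s t, w k * w l * (Q₁ (a k) (b l) + η))
      + (∑ k ∈ Finset.Ico s t, ∑ l ∈ Finset.Ico s t, w l * w k * (Q₂ (b l) (a k) + η))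
      ≤ τ * (τ * (N + 2 * η)) := by
    rw [← Finset.sum_add_distrib, hτ, Finset.sum_mul]
    apply Finset.sum_le_sum
    intro k hk
    rw [← Finset.sum_add_distrib, Finset.sum_mul, Finset.mul_sum]
    apply Finset.sum_le_sum
    intro l hl
    rw [Finset.mem_Ico] at hk hl
    have h4 := mul_nonneg (hw k hk.1 hk.2) (hw l hl.1 hl.2)
    have h5 := mul_le_mul_of_nonneg_left (hN (a k) (b l)) h4
    linarith
  have h4 : τ * (u t (a t) + v t (b t) - (u s (a s) + v s (b s)))
      ≤ τ * ((N + 2 * η) * τ + 2 * D) := by linarith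
  exact le_of_mul_le_mul_left h4 hpos

/-- A weighted interval of total weight at least `L` has a final window of weight in
`[L, L + 1]` when the individual weights are at most `1`. -/
lemma exists_window {w : ℕ → ℝ} {s t : ℕ} {L : ℝ} (hL : 0 < L)
    (hw1 : ∀ k, s ≤ k → k < t → w k ≤ 1)
    (h : L ≤ ∑ k ∈ Finset.Ico s t, w k) :
    ∃ m, s ≤ m ∧ m < t ∧ L ≤ ∑ k ∈ Finset.Ico m t, w k ∧
      ∑ k ∈ Finset.Ico m t, w k ≤ L + 1 := by
  have hst : s ≤ t := by
    by_contra hc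
    rw [Finset.Ico_eq_empty_of_le (by omega)] at h
    simp at h
    linarith
  obtain ⟨d, rfl⟩ := Nat.exists_eq_add_of_le hst
  induction d generalizing s with
  | zero => simp at h; linarith
  | succ d ih =>
    by_cases hc : L ≤ ∑ k ∈ Finset.Ico (s + 1) (s + (d + 1)), w k
    · have e : s + (d + 1) = s + 1 + d := by omega
      rw [e] at hc hw1 ⊢
      obtain ⟨m, h1, h2⟩ := ih (fun k hk => hw1 k (by omega)) hc (by omega)
      exact ⟨m, by omega, h2⟩
    · refine ⟨s, le_rfl, by omega, h, ?_⟩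
      rw [Finset.sum_eq_sum_Ico_succ_bot (by omega)]
      have := hw1 s le_rfl (by omega)
      linarith

/-- Robinson's estimate for perturbed fictitious play with arbitrary weights in `[0, 1]`: up to an
additive constant, the sum of the maximal payoffs grows at a rate at most `N + 2 * η + ε`. -/
lemma exists_growth_le_of_card {I J : Type} [Fintype I] [Fintype J] {B : ℝ} (hB : 0 ≤ B) (n : ℕ) :
    ∀ ε : ℝ, 0 < ε → ∃ K : ℝ, 0 ≤ K ∧ ∀ (η N : ℝ) (Q₁ : I → J → ℝ) (Q₂ : J → I → ℝ)
      (w : ℕ → ℝ) (s t : ℕ) (u : ℕ → I → ℝ) (v : ℕ → J → ℝ) (a : ℕ → I) (b : ℕ → J),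
      0 ≤ η → 0 ≤ N → IsResponse B η Q₁ w s t u a b → IsResponse B η Q₂ w s t v b a →
      (∀ k, s ≤ k → k < t → 0 ≤ w k) → (∀ k, s ≤ k → k < t → w k ≤ 1) →
      (∀ i j, Q₁ i j + Q₂ j i ≤ N) → s ≤ t →
      (eligible u s t).card + (eligible v s t).card ≤ n →
      u t (a t) + v t (b t) - (u s (a s) + v s (b s))
        ≤ (N + 2 * η + ε) * (∑ k ∈ Finset.Ico s t, w k) + K := by
  induction n with
  | zero =>
    intro ε _
    refine ⟨0, le_rfl, ?_⟩
    intro η N Q₁ Q₂ w s t u v a b _ _ hu _ _ _ _ hst hc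
    have : a s ∈ eligible u s t := mem_eligible.2 ⟨s, le_rfl, hst, hu.le_max s le_rfl hst⟩
    have := Finset.card_pos.2 ⟨_, this⟩
    omega
  | succ n ih =>
    intro ε hε
    obtain ⟨K', hK', hgrow⟩ := ih (ε / 2) (half_pos hε)
    set L := 2 * K' / ε + 1 with hL
    have hL0 : 0 < L := by positivity
    have hLK : K' ≤ ε / 2 * L := by
      rw [hL]
      have : ε / 2 * (2 * K' / ε + 1) = K' + ε / 2 := by field_simp
      linarith
    refine ⟨4 * B * (L + 1), by positivity, ?_⟩
    intro η N Q₁ Q₂ w s t u v a b hη hN hu hv hw hw1 hNQ hst hc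
    induction t using Nat.strong_induction_on with
    | _ t iht =>
    have hτ : 0 ≤ ∑ k ∈ Finset.Ico s t, w k := by
      apply Finset.sum_nonneg
      intro k hk
      rw [Finset.mem_Ico] at hk
      exact hw k hk.1 hk.2
    by_cases hlong : L ≤ ∑ k ∈ Finset.Ico s t, w k
    · obtain ⟨m, hsm, hmt, hm1, hm2⟩ := exists_window hL0 hw1 hlong
      have hw' : ∀ k, m ≤ k → k < t → 0 ≤ w k := fun k h1 => hw k (hsm.trans h1)
      have hu' := hu.mono hsm le_rfl
      have hv' := hv.mono hsm le_rfl
      by_cases hcard : (eligible u m t).card + (eligible v m t).card ≤ n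
      · have h1 := hgrow η N Q₁ Q₂ w m t u v a b hη hN hu' hv' hw'
          (fun k h1 => hw1 k (hsm.trans h1)) hNQ hmt.le hcard
        have h2 := iht m hmt (hu.mono le_rfl hmt.le) (hv.mono le_rfl hmt.le)
          (fun k h1 h2 => hw k h1 (h2.trans hmt)) (fun k h1 h2 => hw1 k h1 (h2.trans hmt)) hsm
          ((add_le_add (Finset.card_le_card (eligible_mono u le_rfl hmt.le))
            (Finset.card_le_card (eligible_mono v le_rfl hmt.le))).trans hc)
        rw [← Finset.sum_Ico_consecutive w hsm hmt.le]
        have h3 := mul_le_mul_of_nonneg_left hm1 (half_pos hε).le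
        linarith
      · have hsu := eligible_mono u hsm (le_refl t)
        have hsv := eligible_mono v hsm (le_refl t)
        have hcu := Finset.card_le_card hsu
        have hcv := Finset.card_le_card hsv
        have eu := Finset.eq_of_subset_of_card_le hsu (by omega)
        have ev := Finset.eq_of_subset_of_card_le hsv (by omega)
        have hD := mul_le_mul_of_nonneg_left hm2 (show 0 ≤ 2 * B by positivity)
        have h1 := growth_le_of_near_max (D := 2 * B * (L + 1)) hu hv hw hNQ hst
          (hL0.trans_le hlong)
          (by
            intro k h1 h2
            have : a k ∈ eligible u m t := by
              rw [eu]
              exact mem_eligible.2 ⟨k, h1, h2.le, hu.le_max k h1 h2.le⟩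
            obtain ⟨j, h3, h4, h5⟩ := mem_eligible.1 this
            have := hu'.near_max hw' hB h3 h4 h5
            linarith)
          (by
            intro k h1 h2
            have : b k ∈ eligible v m t := by
              rw [ev]
              exact mem_eligible.2 ⟨k, h1, h2.le, hv.le_max k h1 h2.le⟩
            obtain ⟨j, h3, h4, h5⟩ := mem_eligible.1 this
            have := hv'.near_max hw' hB h3 h4 h5
            linarith)
        have h2 := mul_nonneg hε.le hτ
        linarith
    · have h1 := hu.max_sub_le hst
      have h2 := hv.max_sub_le hst
      have h3 := mul_le_mul_of_nonneg_right (not_le.1 hlong).le hB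
      have h4 : 0 ≤ (N + 2 * η + ε) * (∑ k ∈ Finset.Ico s t, w k) := by positivity
      have h5 := mul_nonneg hB hL0.le
      linarith

lemma exists_growth_le (I J : Type) [Fintype I] [Fintype J] {B : ℝ} (hB : 0 ≤ B)
    {ε : ℝ} (hε : 0 < ε) : ∃ K : ℝ, 0 ≤ K ∧ ∀ (η N : ℝ) (Q₁ : I → J → ℝ) (Q₂ : J → I → ℝ)
      (w : ℕ → ℝ) (s t : ℕ) (u : ℕ → I → ℝ) (v : ℕ → J → ℝ) (a : ℕ → I) (b : ℕ → J),
      0 ≤ η → 0 ≤ N → IsResponse B η Q₁ w s t u a b → IsResponse B η Q₂ w s t v b a →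
      (∀ k, s ≤ k → k < t → 0 ≤ w k) → (∀ k, s ≤ k → k < t → w k ≤ 1) →
      (∀ i j, Q₁ i j + Q₂ j i ≤ N) → s ≤ t →
      u t (a t) + v t (b t) - (u s (a s) + v s (b s))
        ≤ (N + 2 * η + ε) * (∑ k ∈ Finset.Ico s t, w k) + K := by
  obtain ⟨K, hK, h⟩ :=
    exists_growth_le_of_card (I := I) (J := J) hB (Fintype.card I + Fintype.card J) ε hε
  refine ⟨K, hK, fun η N Q₁ Q₂ w s t u v a b h1 h2 h3 h4 h5 h6 h7 h8 =>
    h η N Q₁ Q₂ w s t u v a b h1 h2 h3 h4 h5 h6 h7 h8 ?_⟩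
  exact add_le_add (Finset.card_le_univ _) (Finset.card_le_univ _)

/-- One side of a fictitious play with slowly varying payoff matrices `P k`: the belief `y` on the
opponent's mixed action moves towards the action `b k` with step size `α k`, the player best
responds to it with `a k`, and `P` moves by at most `β k * C`. -/
structure IsBestReply {I J : Type} [Fintype J] [DecidableEq J] (B C : ℝ) (α β : ℕ → ℝ)
    (P : ℕ → I → J → ℝ) (y : ℕ → J → ℝ) (a : ℕ → I) (b : ℕ → J) : Prop where
  le_max : ∀ k i, ∑ j, P k i j * y k j ≤ ∑ j, P k (a k) j * y k j
  simplex : ∀ k, y k ∈ stdSimplex ℝ J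
  belief_step : ∀ k j, y (k + 1) j = y k j + α k * ((if j = b k then (1 : ℝ) else 0) - y k j)
  payoff_bound : ∀ k i j, |P k i j| ≤ B
  payoff_step : ∀ k i j, |P (k + 1) i j - P k i j| ≤ β k * C

lemma abs_sum_mul_simplex_le {J : Type} [Fintype J] {f y : J → ℝ} {c : ℝ}
    (hy : y ∈ stdSimplex ℝ J) (hf : ∀ j, |f j| ≤ c) : |∑ j, f j * y j| ≤ c := by
  calc |∑ j, f j * y j| ≤ ∑ j, |f j * y j| := Finset.abs_sum_le_sum_abs _ _
    _ ≤ ∑ j, c * y j := by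
      apply Finset.sum_le_sum
      intro j _
      rw [abs_mul, abs_of_nonneg (hy.1 j)]
      exact mul_le_mul_of_nonneg_right (hf j) (hy.1 j)
    _ = c := by rw [← Finset.mul_sum, hy.2, mul_one]

lemma le_add_of_drift {f α : ℕ → ℝ} {m k : ℕ} {c : ℝ} (hmk : m ≤ k)
    (h : ∀ j, m ≤ j → j < k → f j - f (j + 1) ≤ c * α j) :
    f m ≤ f k + c * ∑ j ∈ Finset.Ico m k, α j := by
  induction k, hmk using Nat.le_induction with
  | base => simp
  | succ k hmk ih =>
    rw [Finset.sum_Ico_succ_top hmk]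
    have h1 := ih fun j h1 h2 => h j h1 (h2.trans (Nat.lt_succ_self k))
    have h2 := h k hmk (Nat.lt_succ_self k)
    linarith

namespace IsBestReply

variable {I J : Type} [Fintype J] [DecidableEq J] {B C : ℝ} {α β : ℕ → ℝ}
  {P : ℕ → I → J → ℝ} {y : ℕ → J → ℝ} {a : ℕ → I} {b : ℕ → J}

lemma abs_value_le (h : IsBestReply B C α β P y a b) (k : ℕ) (i : I) :
    |∑ j, P k i j * y k j| ≤ B :=
  abs_sum_mul_simplex_le (h.simplex k) (h.payoff_bound k i)

lemma payoff_drift (h : IsBestReply B C α β P y a b) {m k : ℕ} {η : ℝ} (hmk : m ≤ k)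
    (hC : 0 ≤ C) (hβ : ∀ j, m ≤ j → j < k → β j ≤ η * α j) (i : I) (j : J) :
    |P k i j - P m i j| ≤ C * η * ∑ l ∈ Finset.Ico m k, α l := by
  have hstep : ∀ l, m ≤ l → l < k → |P (l + 1) i j - P l i j| ≤ C * η * α l := by
    intro l h1 h2
    have := mul_le_mul_of_nonneg_right (hβ l h1 h2) hC
    linarith [h.payoff_step l i j]
  rw [abs_le]
  constructor
  · have := le_add_of_drift (f := fun l => P l i j) (α := α) (c := C * η) hmk
      fun l h1 h2 => by linarith [(abs_le.1 (hstep l h1 h2)).1]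
    linarith
  · have := le_add_of_drift (f := fun l => - P l i j) (α := α) (c := C * η) hmk
      fun l h1 h2 => by linarith [(abs_le.1 (hstep l h1 h2)).2]
    linarith

/-- Undiscounting a fictitious play over a window gives a perturbed play with a fixed matrix. -/
lemma isResponse (h : IsBestReply B C α β P y a b) {m t : ℕ} {η σ : ℝ} {ρ : ℕ → ℝ}
    (hC : 0 ≤ C) (hη : 0 ≤ η) (hη1 : η ≤ 1) (hσ : 0 < σ) (hα : ∀ k, 0 ≤ α k)
    (hβ : ∀ k, m ≤ k → β k ≤ η * α k)
    (hsum : ∑ k ∈ Finset.Ico m t, α k ≤ 2) (hρ : ∀ k, 0 < ρ k)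
    (hρs : ∀ k, m ≤ k → ρ (k + 1) * (1 - α k) = ρ k) :
    IsResponse (B + 3 * C) (3 * C * η) (P m) (fun k => (ρ (k + 1) - ρ k) / σ) m t
      (fun k i => ρ k / σ * ∑ j, P k i j * y k j) a b := by
  have hw : ∀ k, m ≤ k → (ρ (k + 1) - ρ k) / σ = ρ (k + 1) / σ * α k := by
    intro k hk
    rw [← hρs k hk]
    ring
  have hstep : ∀ k, m ≤ k → k < t → ∀ i,
      |ρ (k + 1) / σ * ∑ j, P (k + 1) i j * y (k + 1) j - ρ k / σ * ∑ j, P k i j * y k j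
        - (ρ (k + 1) - ρ k) / σ * P m i (b k)| ≤ (ρ (k + 1) - ρ k) / σ * (3 * C * η) := by
    intro k hk hkt i
    have e1 : ∑ j, P k i j * y (k + 1) j
        = (1 - α k) * ∑ j, P k i j * y k j + α k * P k i (b k) := by
      have : ∀ j, P k i j * y (k + 1) j
          = (1 - α k) * (P k i j * y k j) + α k * (if j = b k then P k i j else 0) := by
        intro j
        rw [h.belief_step]
        split_ifs <;> ring
      rw [Finset.sum_congr rfl fun j _ => this j, Finset.sum_add_distrib, ← Finset.mul_sum,
        ← Finset.mul_sum]
      simp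
    have e2 : ∑ j, P (k + 1) i j * y (k + 1) j
        = ∑ j, (P (k + 1) i j - P k i j) * y (k + 1) j + ∑ j, P k i j * y (k + 1) j := by
      rw [← Finset.sum_add_distrib]
      exact Finset.sum_congr rfl fun j _ => by ring
    have h1 : |∑ j, (P (k + 1) i j - P k i j) * y (k + 1) j| ≤ β k * C :=
      abs_sum_mul_simplex_le (h.simplex (k + 1)) (h.payoff_step k i)
    have h1' : β k * C ≤ η * α k * C := mul_le_mul_of_nonneg_right (hβ k hk) hC
    have h2 : |P k i (b k) - P m i (b k)| ≤ C * η * 2 := by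
      refine (h.payoff_drift hk hC (fun j h1 _ => hβ j h1) i (b k)).trans ?_
      apply mul_le_mul_of_nonneg_left _ (by positivity)
      refine le_trans ?_ hsum
      apply Finset.sum_le_sum_of_subset_of_nonneg
      · exact Finset.Ico_subset_Ico le_rfl hkt.le
      · exact fun j _ _ => hα j
    have h3 : |α k * (P k i (b k) - P m i (b k))| ≤ α k * (C * η * 2) := by
      rw [abs_mul, abs_of_nonneg (hα k)]
      exact mul_le_mul_of_nonneg_left h2 (hα k)
    have e3 : ρ (k + 1) / σ * ∑ j, P (k + 1) i j * y (k + 1) j - ρ k / σ * ∑ j, P k i j * y k j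
        - (ρ (k + 1) - ρ k) / σ * P m i (b k)
        = ρ (k + 1) / σ * (∑ j, (P (k + 1) i j - P k i j) * y (k + 1) j
          + α k * (P k i (b k) - P m i (b k))) := by
      rw [hw k hk, e2, e1, ← hρs k hk]
      ring
    have hpos : 0 < ρ (k + 1) / σ := div_pos (hρ _) hσ
    rw [e3, hw k hk, abs_mul, abs_of_pos hpos, mul_assoc]
    apply mul_le_mul_of_nonneg_left _ hpos.le
    refine (abs_add_le _ _).trans ?_
    linarith
  refine ⟨?_, hstep, ?_⟩
  · intro k _ _ i
    exact mul_le_mul_of_nonneg_left (h.le_max k i) (div_pos (hρ k) hσ).le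
  · intro k hk hkt i
    have hw0 : 0 ≤ (ρ (k + 1) - ρ k) / σ := by
      rw [hw k hk]
      exact mul_nonneg (div_pos (hρ _) hσ).le (hα k)
    have h1 := abs_le.1 (hstep k hk hkt i)
    have h2 := abs_le.1 (h.payoff_bound m i (b k))
    have h3 := mul_le_mul_of_nonneg_left h2.1 hw0
    have h4 := mul_le_mul_of_nonneg_left h2.2 hw0
    have h5 : (ρ (k + 1) - ρ k) / σ * (3 * C * η) ≤ (ρ (k + 1) - ρ k) / σ * (3 * C) := by
      apply mul_le_mul_of_nonneg_left _ hw0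
      have := mul_le_mul_of_nonneg_left hη1 (show 0 ≤ 3 * C by positivity)
      linarith
    rw [abs_le]
    constructor <;> linarith

end IsBestReply

/-- The inverse discount weights, normalized to be `1` at stage `m`. -/
lemma exists_undiscount {α : ℕ → ℝ} {m : ℕ} (hα : ∀ k, 0 ≤ α k) (hα1 : ∀ k, m ≤ k → α k < 1) :
    ∃ ρ : ℕ → ℝ, ρ m = 1 ∧ (∀ k, 0 < ρ k) ∧ (∀ k, m ≤ k → ρ (k + 1) * (1 - α k) = ρ k) ∧
      (∀ k, m ≤ k → 1 + ∑ j ∈ Finset.Ico m k, α j ≤ ρ k) ∧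
      (∀ k l, m ≤ k → k ≤ l → ρ k ≤ ρ l) := by
  have hpos : ∀ k, 0 < ∏ j ∈ Finset.Ico m k, (1 - α j)⁻¹ := by
    intro k
    apply Finset.prod_pos
    intro j hj
    rw [Finset.mem_Ico] at hj
    exact inv_pos.2 (by linarith [hα1 j hj.1])
  have hs : ∀ k, m ≤ k → (∏ j ∈ Finset.Ico m (k + 1), (1 - α j)⁻¹) * (1 - α k)
      = ∏ j ∈ Finset.Ico m k, (1 - α j)⁻¹ := by
    intro k hk
    have : 1 - α k ≠ 0 := by linarith [hα1 k hk]
    rw [Finset.prod_Ico_succ_top hk, mul_assoc, inv_mul_cancel₀ this, mul_one]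
  refine ⟨fun k => ∏ j ∈ Finset.Ico m k, (1 - α j)⁻¹, by simp, hpos, hs, ?_, ?_⟩
  · intro k hk
    induction k, hk using Nat.le_induction with
    | base => simp
    | succ k hk ih =>
      rw [Finset.sum_Ico_succ_top hk]
      have h1 := hs k hk
      have h2 := mul_nonneg (hpos (k + 1)).le (hα k)
      have h3 : 0 ≤ ∑ j ∈ Finset.Ico m k, α j := Finset.sum_nonneg fun j _ => hα j
      have h4 : 1 ≤ ∏ j ∈ Finset.Ico m (k + 1), (1 - α j)⁻¹ := by linarith
      have h5 := mul_le_mul_of_nonneg_right h4 (hα k)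
      linarith
  · intro k l hk hkl
    induction l, hkl using Nat.le_induction with
    | base => exact le_rfl
    | succ l hkl ih =>
      have h1 := hs l (hk.trans hkl)
      have h2 := mul_nonneg (hpos (l + 1)).le (hα l)
      linarith

section Convergence

variable {I J : Type} [Fintype I] [Fintype J] [DecidableEq I] [DecidableEq J] {B C : ℝ}
  {α β N : ℕ → ℝ} {P : ℕ → I → J → ℝ} {R : ℕ → J → I → ℝ} {x : ℕ → I → ℝ} {y : ℕ → J → ℝ}
  {a : ℕ → I} {b : ℕ → J}

/-- The excess of the total value over the defect `N` from being zero-sum halves over a window of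
weight at least `1`, up to small errors. -/
lemma excess_le_half_add (hP : IsBestReply B C α β P y a b) (hR : IsBestReply B C α β R x b a)
    (hB : 0 ≤ B) (hC : 0 ≤ C) (hα : ∀ k, 0 ≤ α k) (hN0 : ∀ k, 0 ≤ N k)
    (hN : ∀ k i j, P k i j + R k j i ≤ N k) (hNs : ∀ k, N k - N (k + 1) ≤ 2 * C * β k)
    {ε : ℝ} (hε : 0 < ε) : ∃ K : ℝ, 0 ≤ K ∧ ∀ (m t : ℕ) (η δ M : ℝ), m ≤ t → 0 ≤ η → η ≤ 1 →
      0 < δ → (∀ k, m ≤ k → α k < 1) → (∀ k, m ≤ k → α k ≤ δ) → (∀ k, m ≤ k → β k ≤ η * α k) →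
      1 ≤ ∑ k ∈ Finset.Ico m t, α k → ∑ k ∈ Finset.Ico m t, α k ≤ 2 → 0 ≤ M →
      ∑ j, P m (a m) j * y m j + ∑ i, R m (b m) i * x m i - N m ≤ M →
      ∑ j, P t (a t) j * y t j + ∑ i, R t (b t) i * x t i - N t
        ≤ M / 2 + (10 * C * η + ε + K * δ) := by
  obtain ⟨K, hK, hgrow⟩ := exists_growth_le I J (B := B + 3 * C) (by positivity) hε
  refine ⟨K, hK, ?_⟩
  intro m t η δ M hmt hη hη1 hδ hα1 hαδ hβ hs1 hs2 hM hle
  obtain ⟨ρ, hρm, hρ, hρs, hρg, hρmono⟩ := exists_undiscount hα hα1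
  have hσ : 0 < ρ t * δ := mul_pos (hρ t) hδ
  have hw : ∀ k, m ≤ k → ρ (k + 1) - ρ k = ρ (k + 1) * α k := by
    intro k hk
    rw [← hρs k hk]
    ring
  have h1 := hgrow (3 * C * η) (N m) (P m) (R m) (fun k => (ρ (k + 1) - ρ k) / (ρ t * δ)) m t
    (fun k i => ρ k / (ρ t * δ) * ∑ j, P k i j * y k j)
    (fun k j => ρ k / (ρ t * δ) * ∑ i, R k j i * x k i) a b (by positivity) (hN0 m)
    (hP.isResponse hC hη hη1 hσ hα hβ hs2 hρ hρs) (hR.isResponse hC hη hη1 hσ hα hβ hs2 hρ hρs)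
    (fun k hk _ => by
      simp only [hw k hk]
      exact div_nonneg (mul_nonneg (hρ _).le (hα k)) hσ.le)
    (fun k hk hkt => by
      simp only [hw k hk]
      rw [div_le_one hσ]
      exact mul_le_mul (hρmono (k + 1) t (by omega) hkt) (hαδ k hk) (hα k) (hρ t).le)
    (hN m) hmt
  rw [← Finset.sum_div, Finset.sum_Ico_sub ρ hmt, hρm] at h1
  set g := ∑ j, P t (a t) j * y t j + ∑ i, R t (b t) i * x t i with hg
  set g0 := ∑ j, P m (a m) j * y m j + ∑ i, R m (b m) i * x m i with hg0
  have h2 : (ρ t * g - g0) / (ρ t * δ)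
      ≤ ((N m + 2 * (3 * C * η) + ε) * (ρ t - 1) + K * (ρ t * δ)) / (ρ t * δ) := by
    rw [add_div, mul_div_assoc, mul_div_cancel_right₀ K hσ.ne']
    refine le_of_eq_of_le ?_ h1
    rw [hg, hg0]
    ring
  have h3 := (div_le_div_iff_of_pos_right hσ).1 h2
  have h4 : 2 ≤ ρ t := by linarith [hρg t hmt]
  have h5 : N m ≤ N t + 2 * C * η * ∑ k ∈ Finset.Ico m t, α k := by
    apply le_add_of_drift hmt
    intro k hk _
    have := mul_le_mul_of_nonneg_left (hβ k hk) (show 0 ≤ 2 * C by positivity)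
    linarith [hNs k]
  have h6 : 2 * C * η * ∑ k ∈ Finset.Ico m t, α k ≤ 2 * C * η * 2 :=
    mul_le_mul_of_nonneg_left hs2 (by positivity)
  have h7 : M * 2 ≤ M * ρ t := mul_le_mul_of_nonneg_left h4 hM
  have h8 : 0 ≤ C * η := by positivity
  have h9 : ρ t * (g - N m) ≤ ρ t * (M / 2 + (6 * C * η + ε + K * δ)) := by linarith
  have h10 := le_of_mul_le_mul_left h9 (hρ t)
  linarith

lemma eventually_excess_le (hP : IsBestReply B C α β P y a b) (hR : IsBestReply B C α β R x b a)
    (hB : 0 ≤ B) (hC : 0 ≤ C) (hα : ∀ k, 0 < α k) (hN0 : ∀ k, 0 ≤ N k)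
    (hN : ∀ k i j, P k i j + R k j i ≤ N k) (hNs : ∀ k, N k - N (k + 1) ≤ 2 * C * β k)
    (hαsum : Tendsto (fun n => ∑ c ∈ Finset.range n, α c) atTop atTop)
    (hα0 : Tendsto α atTop (𝓝 0)) (hβα : Tendsto (fun c => β c / α c) atTop (𝓝 0))
    {ε : ℝ} (hε : 0 < ε) :
    ∀ᶠ k in atTop, ∑ j, P k (a k) j * y k j + ∑ i, R k (b k) i * x k i - N k ≤ ε := by
  set ε' := ε / 12 with hε'
  have hε'0 : 0 < ε' := by positivity
  obtain ⟨K, hK, hhalf⟩ :=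
    excess_le_half_add hP hR hB hC (fun k => (hα k).le) hN0 hN hNs hε'0
  set δ := min (1 / 2) (ε' / (K + 1)) with hδ
  have hδ0 : 0 < δ := lt_min (by norm_num) (by positivity)
  have hKδ : K * δ ≤ ε' := by
    have h1 : δ * (K + 1) ≤ ε' := (le_div_iff₀ (by positivity)).1 (min_le_right _ _)
    linarith
  set η := min 1 (ε' / (10 * C + 1)) with hη
  have hη0 : 0 < η := lt_min (by norm_num) (by positivity)
  have hCη : 10 * C * η ≤ ε' := by
    have h1 : η * (10 * C + 1) ≤ ε' := (le_div_iff₀ (by positivity)).1 (min_le_right _ _)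
    linarith
  obtain ⟨k₀, hk₀⟩ := eventually_atTop.1 ((hα0.eventually_le_const hδ0).and
    (hβα.eventually_le_const hη0))
  have hβ : ∀ k, k₀ ≤ k → β k ≤ η * α k := fun k hk => (div_le_iff₀ (hα k)).1 (hk₀ k hk).2
  have hiter : ∀ n : ℕ, ∃ s, k₀ ≤ s ∧ ∀ k, s ≤ k →
      ∑ j, P k (a k) j * y k j + ∑ i, R k (b k) i * x k i - N k
        ≤ 2 * B / 2 ^ n + 6 * ε' := by
    intro n
    induction n with
    | zero =>
      refine ⟨k₀, le_rfl, fun k _ => ?_⟩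
      have h1 := (abs_le.1 (hP.abs_value_le k (a k))).2
      have h2 := (abs_le.1 (hR.abs_value_le k (b k))).2
      have h3 := hN0 k
      rw [pow_zero, div_one]
      linarith
    | succ n ih =>
      obtain ⟨s, hs, hle⟩ := ih
      obtain ⟨t₀, ht₀⟩ := eventually_atTop.1
        (hαsum.eventually_ge_atTop (1 + ∑ c ∈ Finset.range s, α c))
      refine ⟨max s t₀, hs.trans (le_max_left _ _), fun t ht => ?_⟩
      have hst : s ≤ t := (le_max_left _ _).trans ht
      have h1 := ht₀ t ((le_max_right _ _).trans ht)
      have h2 : 1 ≤ ∑ c ∈ Finset.Ico s t, α c := by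
        rw [Finset.sum_Ico_eq_sub _ hst]
        linarith
      have hδ1 : δ ≤ 1 / 2 := min_le_left _ _
      obtain ⟨m, hsm, hmt, hm1, hm2⟩ := exists_window one_pos
        (fun k hk _ => by linarith [(hk₀ k (hs.trans hk)).1]) h2
      have hkm : k₀ ≤ m := hs.trans hsm
      have h3 := hhalf m t η δ (2 * B / 2 ^ n + 6 * ε') hmt.le hη0.le (min_le_left _ _) hδ0
        (fun k hk => by linarith [(hk₀ k (hkm.trans hk)).1])
        (fun k hk => (hk₀ k (hkm.trans hk)).1) (fun k hk => hβ k (hkm.trans hk)) hm1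
        (by linarith) (by positivity) (hle m hsm)
      have h4 : 2 * B / 2 ^ (n + 1) = 2 * B / 2 ^ n / 2 := by
        rw [pow_succ, div_div]
      rw [h4]
      linarith
  have hpow : Tendsto (fun n : ℕ => 2 * B / 2 ^ n) atTop (𝓝 0) := by
    have := (tendsto_pow_atTop_nhds_zero_of_lt_one (r := (1 / 2 : ℝ)) (by norm_num)
      (by norm_num)).const_mul (2 * B)
    simpa [div_eq_mul_inv] using this
  obtain ⟨n, hn⟩ := (hpow.eventually_le_const hε'0).exists
  obtain ⟨s, _, hs⟩ := hiter n
  refine eventually_atTop.2 ⟨s, fun k hk => ?_⟩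
  have := hs k hk
  linarith

end Convergence

lemma eq_of_count_eq {X : Type} {p : ℕ → Prop} [DecidablePred p] {f : ℕ → X}
    (h : ∀ k, ¬ p k → f (k + 1) = f k) {k l : ℕ} (hkl : Nat.count p k = Nat.count p l) :
    f k = f l := by
  have key : ∀ k l, k ≤ l → Nat.count p k = Nat.count p l → f k = f l := by
    intro k l hle
    induction l, hle using Nat.le_induction with
    | base => simp
    | succ l hle ih =>
      intro hc
      have h1 := Nat.count_monotone p hle
      rw [Nat.count_succ] at hc
      by_cases hp : p l
      · rw [if_pos hp] at hc
        omega
      · rw [if_neg hp] at hc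
        rw [h l hp]
        exact ih hc
  rcases le_total k l with hle | hle
  · exact key k l hle hkl
  · exact (key l k hle hkl.symm).symm

lemma abs_sup'_le {J : Type} [Fintype J] [Nonempty J] {f : J → ℝ} {c : ℝ}
    (hf : ∀ j, |f j| ≤ c) : |Finset.univ.sup' Finset.univ_nonempty f| ≤ c := by
  obtain ⟨j⟩ := ‹Nonempty J›
  rw [abs_le]
  constructor
  · exact (abs_le.1 (hf j)).1.trans (Finset.le_sup' f (Finset.mem_univ j))
  · exact Finset.sup'_le _ _ fun i _ => (abs_le.1 (hf i)).2

lemma sup'_univ_eq_of_forall_le {J : Type} [Fintype J] [Nonempty J] {f : J → ℝ} {j : J}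
    (hj : ∀ i, f i ≤ f j) : Finset.univ.sup' Finset.univ_nonempty f = f j :=
  le_antisymm (Finset.sup'_le _ _ fun i _ => hj i) (Finset.le_sup' f (Finset.mem_univ j))

lemma abs_le_maxNorm {I J : Type} [Fintype I] [Fintype J] [Nonempty I] [Nonempty J]
    (F : I → J → ℝ) (i : I) (j : J) : |F i j| ≤ maxNorm F :=
  Finset.le_sup' (fun q : I × J => |F q.1 q.2|) (Finset.mem_univ (i, j))

lemma maxNorm_le {I J : Type} [Fintype I] [Fintype J] [Nonempty I] [Nonempty J]
    {F : I → J → ℝ} {c : ℝ} (h : ∀ i j, |F i j| ≤ c) : maxNorm F ≤ c :=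
  Finset.sup'_le _ _ fun q _ => h q.1 q.2

lemma maxNorm_nonneg {I J : Type} [Fintype I] [Fintype J] [Nonempty I] [Nonempty J]
    (F : I → J → ℝ) : 0 ≤ maxNorm F :=
  (abs_nonneg _).trans (abs_le_maxNorm F (Classical.arbitrary I) (Classical.arbitrary J))

lemma abs_bellman_le {X : Type} [Fintype X] {B R γ r : ℝ} {v q : X → ℝ} (hγ : 0 ≤ γ)
    (hR : R + γ * B = B) (hr : |r| ≤ R) (hv : ∀ x, |v x| ≤ B) (hq : q ∈ stdSimplex ℝ X) :
    |r + γ * ∑ x, v x * q x| ≤ B := by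
  have h1 := abs_sum_mul_simplex_le hq hv
  refine (abs_add_le _ _).trans ?_
  rw [abs_mul, abs_of_nonneg hγ]
  have h2 := mul_le_mul_of_nonneg_left h1 hγ
  linarith

lemma abs_relax_le {B c q z : ℝ} (hc0 : 0 ≤ c) (hc1 : c ≤ 1) (hq : |q| ≤ B) (hz : |z| ≤ B) :
    |q + c * (z - q)| ≤ B := by
  rw [abs_le] at *
  have hc : 0 ≤ 1 - c := by linarith
  have h1 := mul_le_mul_of_nonneg_left hz.1 hc0
  have h2 := mul_le_mul_of_nonneg_left hz.2 hc0
  have h3 := mul_le_mul_of_nonneg_left hq.1 hc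
  have h4 := mul_le_mul_of_nonneg_left hq.2 hc
  constructor <;> linarith

namespace MBFP

lemma cnt_eq_count (G : MBFP S A1 A2) (s : S) (k : ℕ) :
    G.cnt s k = Nat.count (fun k' => G.st k' = s) k := by
  rw [Nat.count_eq_card_filter_range]
  rfl

lemma p_simplex (G : MBFP S A1 A2) (s : S) (i : A1) (j : A2) : G.p s i j ∈ stdSimplex ℝ S :=
  ⟨G.p_nonneg s i j, G.p_sum_one s i j⟩

lemma Q1_succ (G : MBFP S A1 A2) (s : S) (k : ℕ) (i : A1) (j : A2) :
    G.Q1 s (k + 1) i j = G.Q1 s k i j + (if s = G.st k then G.β (G.cnt s k) else 0) *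
      (G.r1 s i j + G.γ * ∑ s', G.vhat1 k s' * G.p s i j s' - G.Q1 s k i j) :=
  congrFun (congrFun (G.Q1_upd s k) i) j

lemma Q2_succ (G : MBFP S A1 A2) (s : S) (k : ℕ) (i : A1) (j : A2) :
    G.Q2 s (k + 1) i j = G.Q2 s k i j + (if s = G.st k then G.β (G.cnt s k) else 0) *
      (G.r2 s i j + G.γ * ∑ s', G.vhat2 k s' * G.p s i j s' - G.Q2 s k i j) :=
  congrFun (congrFun (G.Q2_upd s k) i) j

lemma π1_succ (G : MBFP S A1 A2) (s : S) (k : ℕ) (i : A1) :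
    G.π1 s (k + 1) i = G.π1 s k i + (if s = G.st k then G.α (G.cnt s k) else 0) *
      ((if i = G.astar1 k then (1 : ℝ) else 0) - G.π1 s k i) :=
  congrFun (G.π1_upd s k) i

lemma π2_succ (G : MBFP S A1 A2) (s : S) (k : ℕ) (j : A2) :
    G.π2 s (k + 1) j = G.π2 s k j + (if s = G.st k then G.α (G.cnt s k) else 0) *
      ((if j = G.astar2 k then (1 : ℝ) else 0) - G.π2 s k j) :=
  congrFun (G.π2_upd s k) j

lemma abs_vhat1_le (G : MBFP S A1 A2) {B : ℝ} {k : ℕ} {s : S}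
    (h : ∀ i j, |G.Q1 s k i j| ≤ B) : |G.vhat1 k s| ≤ B :=
  abs_sup'_le fun i => abs_sum_mul_simplex_le (G.π2_simplex s k) (h i)

lemma abs_vhat2_le (G : MBFP S A1 A2) {B : ℝ} {k : ℕ} {s : S}
    (h : ∀ i j, |G.Q2 s k i j| ≤ B) : |G.vhat2 k s| ≤ B := by
  refine abs_sup'_le fun j => ?_
  simp_rw [mul_comm (G.π1 s k _)]
  exact abs_sum_mul_simplex_le (G.π1_simplex s k) fun i => h i j

/-- The beliefs on the Q-functions stay bounded, and so do their update targets. -/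
lemma exists_bound (G : MBFP S A1 A2) : ∃ B : ℝ, 0 ≤ B ∧
    (∀ k s i j, |G.Q1 s k i j| ≤ B ∧ |G.Q2 s k i j| ≤ B) ∧
    (∀ k s i j, |G.r1 s i j + G.γ * ∑ s', G.vhat1 k s' * G.p s i j s'| ≤ B ∧
      |G.r2 s i j + G.γ * ∑ s', G.vhat2 k s' * G.p s i j s'| ≤ B) := by
  obtain ⟨R, hR⟩ := (Set.finite_range
    fun q : S × A1 × A2 => |G.r1 q.1 q.2.1 q.2.2| + |G.r2 q.1 q.2.1 q.2.2|).bddAbove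
  have hR' : ∀ s i j, |G.r1 s i j| + |G.r2 s i j| ≤ R := fun s i j => hR ⟨(s, i, j), rfl⟩
  have hR0 : 0 ≤ R := le_trans (by positivity)
    (hR' (Classical.arbitrary S) (Classical.arbitrary A1) (Classical.arbitrary A2))
  have hγ : 0 < 1 - G.γ := by linarith [G.γ_lt_one]
  obtain ⟨B, hB⟩ : ∃ B, B = R / (1 - G.γ) := ⟨_, rfl⟩
  have hB0 : 0 ≤ B := hB ▸ div_nonneg hR0 hγ.le
  have hRB : R + G.γ * B = B := by
    have : B * (1 - G.γ) = R := by rw [hB, div_mul_cancel₀ _ hγ.ne']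
    linarith
  have hRle : R ≤ B := by linarith [mul_nonneg G.γ_nonneg hB0]
  have hr1 : ∀ s i j, |G.r1 s i j| ≤ R := fun s i j => by
    linarith [hR' s i j, abs_nonneg (G.r2 s i j)]
  have hr2 : ∀ s i j, |G.r2 s i j| ≤ R := fun s i j => by
    linarith [hR' s i j, abs_nonneg (G.r1 s i j)]
  have htarget : ∀ k, (∀ s i j, |G.Q1 s k i j| ≤ B ∧ |G.Q2 s k i j| ≤ B) → ∀ s i j,
      |G.r1 s i j + G.γ * ∑ s', G.vhat1 k s' * G.p s i j s'| ≤ B ∧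
      |G.r2 s i j + G.γ * ∑ s', G.vhat2 k s' * G.p s i j s'| ≤ B := fun k h s i j =>
    ⟨abs_bellman_le G.γ_nonneg hRB (hr1 s i j)
      (fun s' => G.abs_vhat1_le fun i j => (h s' i j).1) (G.p_simplex s i j),
     abs_bellman_le G.γ_nonneg hRB (hr2 s i j)
      (fun s' => G.abs_vhat2_le fun i j => (h s' i j).2) (G.p_simplex s i j)⟩
  have hQ : ∀ k s i j, |G.Q1 s k i j| ≤ B ∧ |G.Q2 s k i j| ≤ B := by
    intro k
    induction k with
    | zero =>
      intro s i j
      rw [G.Q1_init, G.Q2_init]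
      exact ⟨(hr1 s i j).trans hRle, (hr2 s i j).trans hRle⟩
    | succ k ih =>
      intro s i j
      have hstep : 0 ≤ (if s = G.st k then G.β (G.cnt s k) else 0) ∧
          (if s = G.st k then G.β (G.cnt s k) else 0) ≤ 1 := by
        split_ifs
        · exact ⟨(G.β_mem _).1.le, (G.β_mem _).2⟩
        · exact ⟨le_rfl, zero_le_one⟩
      rw [G.Q1_succ, G.Q2_succ]
      exact ⟨abs_relax_le hstep.1 hstep.2 (ih s i j).1 (htarget k ih s i j).1,
        abs_relax_le hstep.1 hstep.2 (ih s i j).2 (htarget k ih s i j).2⟩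
  exact ⟨B, hB0, hQ, fun k => htarget k (hQ k)⟩

/-- The stage of the `n`-th visit to `s`. -/
noncomputable def visit (G : MBFP S A1 A2) (s : S) (n : ℕ) : ℕ :=
  Nat.nth (fun k => G.st k = s) n

/-- The beliefs attached to `s` at stage `k`. -/
def beliefs (G : MBFP S A1 A2) (s : S) (k : ℕ) :
    (A1 → A2 → ℝ) × (A1 → A2 → ℝ) × (A1 → ℝ) × (A2 → ℝ) :=
  (G.Q1 s k, G.Q2 s k, G.π1 s k, G.π2 s k)

lemma beliefs_eq_of_cnt_eq (G : MBFP S A1 A2) (s : S) {k l : ℕ} (h : G.cnt s k = G.cnt s l) :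
    G.beliefs s k = G.beliefs s l := by
  rw [cnt_eq_count, cnt_eq_count] at h
  refine eq_of_count_eq (fun k hk => ?_) h
  have hk' : ¬ s = G.st k := fun h => hk h.symm
  have h1 : G.Q1 s (k + 1) = G.Q1 s k := by
    ext i j
    rw [G.Q1_succ, if_neg hk', zero_mul, add_zero]
  have h2 : G.Q2 s (k + 1) = G.Q2 s k := by
    ext i j
    rw [G.Q2_succ, if_neg hk', zero_mul, add_zero]
  have h3 : G.π1 s (k + 1) = G.π1 s k := by
    ext i
    rw [G.π1_succ, if_neg hk', zero_mul, add_zero]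
  have h4 : G.π2 s (k + 1) = G.π2 s k := by
    ext j
    rw [G.π2_succ, if_neg hk', zero_mul, add_zero]
  simp only [beliefs, h1, h2, h3, h4]

lemma infinite_visits (G : MBFP S A1 A2) {s : S}
    (h : Tendsto (fun k => G.cnt s k) atTop atTop) : {k | G.st k = s}.Infinite := by
  intro hfin
  obtain ⟨k, hk⟩ := (h.eventually_gt_atTop hfin.toFinset.card).exists
  refine absurd hk (not_lt.2 (Finset.card_le_card ?_))
  intro j hj
  exact hfin.mem_toFinset.2 (Finset.mem_filter.1 hj).2

lemma st_visit (G : MBFP S A1 A2) {s : S}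
    (h : Tendsto (fun k => G.cnt s k) atTop atTop) (n : ℕ) : G.st (G.visit s n) = s :=
  Nat.nth_mem_of_infinite (G.infinite_visits h) n

lemma cnt_visit (G : MBFP S A1 A2) {s : S}
    (h : Tendsto (fun k => G.cnt s k) atTop atTop) (n : ℕ) : G.cnt s (G.visit s n) = n := by
  rw [cnt_eq_count]
  exact Nat.count_nth_of_infinite (G.infinite_visits h) n

lemma beliefs_visit_succ (G : MBFP S A1 A2) {s : S}
    (h : Tendsto (fun k => G.cnt s k) atTop atTop) (n : ℕ) :
    G.beliefs s (G.visit s (n + 1)) = G.beliefs s (G.visit s n + 1) := by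
  apply G.beliefs_eq_of_cnt_eq
  have h1 := G.cnt_visit h n
  rw [G.cnt_visit h, cnt_eq_count, Nat.count_succ, if_pos (G.st_visit h n), ← cnt_eq_count, h1]

lemma isBestReply_fst (G : MBFP S A1 A2) {s : S}
    (h : Tendsto (fun k => G.cnt s k) atTop atTop) {B : ℝ}
    (hQ : ∀ k s i j, |G.Q1 s k i j| ≤ B)
    (hT : ∀ k s i j, |G.r1 s i j + G.γ * ∑ s', G.vhat1 k s' * G.p s i j s'| ≤ B) :
    IsBestReply B (2 * B) G.α G.β (fun n => G.Q1 s (G.visit s n)) (fun n => G.π2 s (G.visit s n))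
      (fun n => G.astar1 (G.visit s n)) (fun n => G.astar2 (G.visit s n)) where
  le_max n i := by
    have := G.astar1_br (G.visit s n) i
    rwa [G.st_visit h] at this
  simplex n := G.π2_simplex s _
  belief_step n j := by
    have e : G.π2 s (G.visit s (n + 1)) = G.π2 s (G.visit s n + 1) :=
      congrArg (fun q => q.2.2.2) (G.beliefs_visit_succ h n)
    simp only [e]
    rw [G.π2_succ, if_pos (G.st_visit h n).symm, G.cnt_visit h]
  payoff_bound n i j := hQ _ _ _ _
  payoff_step n i j := by
    have e : G.Q1 s (G.visit s (n + 1)) = G.Q1 s (G.visit s n + 1) :=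
      congrArg (fun q => q.1) (G.beliefs_visit_succ h n)
    simp only [e]
    rw [G.Q1_succ, if_pos (G.st_visit h n).symm, G.cnt_visit h, add_sub_cancel_left, abs_mul,
      abs_of_pos (G.β_mem n).1]
    apply mul_le_mul_of_nonneg_left _ (G.β_mem n).1.le
    refine (abs_sub _ _).trans ?_
    linarith [hQ (G.visit s n) s i j, hT (G.visit s n) s i j]

lemma isBestReply_snd (G : MBFP S A1 A2) {s : S}
    (h : Tendsto (fun k => G.cnt s k) atTop atTop) {B : ℝ}
    (hQ : ∀ k s i j, |G.Q2 s k i j| ≤ B)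
    (hT : ∀ k s i j, |G.r2 s i j + G.γ * ∑ s', G.vhat2 k s' * G.p s i j s'| ≤ B) :
    IsBestReply B (2 * B) G.α G.β (fun n j i => G.Q2 s (G.visit s n) i j)
      (fun n => G.π1 s (G.visit s n))
      (fun n => G.astar2 (G.visit s n)) (fun n => G.astar1 (G.visit s n)) where
  le_max n j := by
    have := G.astar2_br (G.visit s n) j
    rw [G.st_visit h] at this
    simpa only [mul_comm] using this
  simplex n := G.π1_simplex s _
  belief_step n i := by
    have e : G.π1 s (G.visit s (n + 1)) = G.π1 s (G.visit s n + 1) :=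
      congrArg (fun q => q.2.2.1) (G.beliefs_visit_succ h n)
    simp only [e]
    rw [G.π1_succ, if_pos (G.st_visit h n).symm, G.cnt_visit h]
  payoff_bound n j i := hQ _ _ _ _
  payoff_step n j i := by
    have e : G.Q2 s (G.visit s (n + 1)) = G.Q2 s (G.visit s n + 1) :=
      congrArg (fun q => q.2.1) (G.beliefs_visit_succ h n)
    simp only [e]
    rw [G.Q2_succ, if_pos (G.st_visit h n).symm, G.cnt_visit h, add_sub_cancel_left, abs_mul,
      abs_of_pos (G.β_mem n).1]
    apply mul_le_mul_of_nonneg_left _ (G.β_mem n).1.le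
    refine (abs_sub _ _).trans ?_
    linarith [hQ (G.visit s n) s i j, hT (G.visit s n) s i j]

/-- The total estimated value exceeds the defect from being zero-sum by a vanishing amount. -/
lemma eventually_vhat_add_le (G : MBFP S A1 A2) (h : G.Assumption1) (s : S) {ε : ℝ}
    (hε : 0 < ε) : ∀ᶠ k in atTop, G.vhat1 k s + G.vhat2 k s
      - maxNorm (fun i j => G.Q1 s k i j + G.Q2 s k i j) ≤ ε := by
  obtain ⟨hcnt, hα, -, hα0, -, hβα⟩ := h
  obtain ⟨B, hB, hQ, hT⟩ := G.exists_bound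
  have h1 := G.isBestReply_fst (hcnt s) (fun k s i j => (hQ k s i j).1)
    fun k s i j => (hT k s i j).1
  have h2 := G.isBestReply_snd (hcnt s) (fun k s i j => (hQ k s i j).2)
    fun k s i j => (hT k s i j).2
  have hev := eventually_excess_le h1 h2 hB (by positivity) (fun k => (G.α_mem k).1)
    (N := fun n => maxNorm fun i j => G.Q1 s (G.visit s n) i j + G.Q2 s (G.visit s n) i j)
    (fun n => maxNorm_nonneg _)
    (fun n i j => (le_abs_self _).trans
      (abs_le_maxNorm (fun i j => G.Q1 s (G.visit s n) i j + G.Q2 s (G.visit s n) i j) i j))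
    (by
      intro n
      rw [sub_le_iff_le_add]
      refine maxNorm_le fun i j => ?_
      have h3 := abs_le.1 (h1.payoff_step n i j)
      have h4 := abs_le.1 (h2.payoff_step n j i)
      have h5 := abs_le.1 (abs_le_maxNorm (fun i j => G.Q1 s (G.visit s (n + 1)) i j
        + G.Q2 s (G.visit s (n + 1)) i j) i j)
      rw [abs_le]
      constructor <;> linarith [h3.1, h3.2, h4.1, h4.2, h5.1, h5.2])
    hα hα0 hβα hε
  filter_upwards [(hcnt s).eventually hev] with k hk
  have e := G.beliefs_eq_of_cnt_eq s (G.cnt_visit (hcnt s) (G.cnt s k))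
  have e1 : G.Q1 s (G.visit s (G.cnt s k)) = G.Q1 s k := congrArg (fun q => q.1) e
  have e2 : G.Q2 s (G.visit s (G.cnt s k)) = G.Q2 s k := congrArg (fun q => q.2.1) e
  have e3 : G.π1 s (G.visit s (G.cnt s k)) = G.π1 s k := congrArg (fun q => q.2.2.1) e
  have e4 : G.π2 s (G.visit s (G.cnt s k)) = G.π2 s k := congrArg (fun q => q.2.2.2) e
  have e5 := sup'_univ_eq_of_forall_le (h1.le_max (G.cnt s k))
  have e6 := sup'_univ_eq_of_forall_le (h2.le_max (G.cnt s k))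
  rw [← e5, ← e6] at hk
  simpa only [e1, e2, e3, e4, vhat1, vhat2, mul_comm (G.π1 s k _)] using hk

end MBFP

/-- The Lyapunov-function values along the discrete dynamics vanish: for every `λ > 1`
with `γλ < 1`, `(v̂₁ₖ(s) + v̂₂ₖ(s) − λ‖Q̂₁ₛₖ + Q̂₂ₛₖ‖_max)₊ → 0`. -/
theorem lyapunov_values_vanish (G : MBFP S A1 A2) (h : G.Assumption1) (s : S)
    (l : ℝ) (hl : 1 < l) (hgl : G.γ * l < 1) :
    Tendsto (fun k =>
        max (G.vhat1 k s + G.vhat2 k s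
          - l * maxNorm (fun b1 b2 => G.Q1 s k b1 b2 + G.Q2 s k b1 b2)) 0)
      atTop (𝓝 0) := by
  refine tendsto_order.2 ⟨fun c hc => Eventually.of_forall fun k => hc.trans_le (le_max_right _ _),
    fun c hc => ?_⟩
  filter_upwards [G.eventually_vhat_add_le h s (half_pos hc)] with k hk
  have h1 := mul_le_mul_of_nonneg_right hl.le
    (maxNorm_nonneg fun b1 b2 => G.Q1 s k b1 b2 + G.Q2 s k b1 b2)
  exact max_lt (by linarith) hc
end

section
/- (Deterministic asynchronous iteration convergence.) Let N be a finite nonempty index set, γ ∈ (0,1) and D ≥ 0. Let (y_k)_{k≥0} with y_k ∈ ℝ^N satisfy ‖y_k‖_∞ ≤ D for all k, let step sizes β_{n,k} ∈ [0,1] satisfy Σ_{k≥0} β_{n,k} = ∞ and β_{n,k} → 0 (as k → ∞) for each n ∈ N, and let real error sequences (ε̄_k) and (ε_k) satisfy ε̄_k → 0 and ε_k → 0. If for all n ∈ N and all k ≥ 0: y_{n,k+1} ≤ (1 − β_{n,k}) y_{n,k} + β_{n,k} γ ‖y_k‖_∞ + β_{n,k} γ ε̄_k, and y_{n,k+1}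 ≥ (1 − β_{n,k}) y_{n,k} − β_{n,k} γ ‖y_k‖_∞ + β_{n,k} γ ε_k, then lim_{k→∞} ‖y_k‖_∞ = 0. -/
open Finset Filter Topology

/-- the sup-norm of a vector indexed by a finite nonempty type -/
noncomputable def supNorm {N : Type} [Fintype N] [Nonempty N] (v : N → ℝ) : ℝ :=
  Finset.univ.sup' Finset.univ_nonempty fun n => |v n|

theorem abs_le_supNorm {N : Type} [Fintype N] [Nonempty N] (v : N → ℝ) (n : N) :
    |v n| ≤ supNorm v :=
  Finset.le_sup' (fun n => |v n|) (Finset.mem_univ n)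

theorem supNorm_le {N : Type} [Fintype N] [Nonempty N] {v : N → ℝ} {c : ℝ}
    (h : ∀ n, |v n| ≤ c) : supNorm v ≤ c :=
  Finset.sup'_le _ _ fun n _ => h n

theorem supNorm_nonneg {N : Type} [Fintype N] [Nonempty N] (v : N → ℝ) : 0 ≤ supNorm v :=
  (abs_nonneg _).trans (abs_le_supNorm v (Classical.arbitrary N))

/-- A scalar sequence eventually relaxing towards `c` with non-summable step sizes is
eventually below any level exceeding `c`. -/
theorem eventually_le_of_relaxation {a b : ℕ → ℝ} {c d : ℝ} (hcd : c < d)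
    (hb : ∀ k, b k ∈ Set.Icc (0 : ℝ) 1)
    (hsum : Tendsto (fun m => ∑ k ∈ Finset.range m, b k) atTop atTop)
    (h : ∀ᶠ k in atTop, a (k + 1) ≤ (1 - b k) * a k + b k * c) :
    ∀ᶠ k in atTop, a k ≤ d := by
  obtain ⟨K, hK⟩ := eventually_atTop.1 h
  set S : ℕ → ℝ := fun m => ∑ k ∈ Finset.range m, b k with hS
  have key : ∀ k ≥ K, a k - c ≤ |a K - c| * Real.exp (S K - S k) := by
    intro k hk
    induction k, hk using Nat.le_induction with
    | base => simpa using le_abs_self (a K - c)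
    | succ k hk ih =>
      have hSk : S (k + 1) = S k + b k := Finset.sum_range_succ _ _
      have hexp : 1 - b k ≤ Real.exp (-b k) := by
        linarith [Real.add_one_le_exp (-b k)]
      calc a (k + 1) - c ≤ (1 - b k) * (a k - c) := by linarith [hK k hk]
        _ ≤ (1 - b k) * (|a K - c| * Real.exp (S K - S k)) :=
          mul_le_mul_of_nonneg_left ih (by linarith [(hb k).2])
        _ ≤ Real.exp (-b k) * (|a K - c| * Real.exp (S K - S k)) :=
          mul_le_mul_of_nonneg_right hexp (by positivity)
        _ = |a K - c| * Real.exp (S K - S (k + 1)) := by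
          rw [hSk, show S K - (S k + b k) = -b k + (S K - S k) by ring, Real.exp_add]
          ring
  have hlim : Tendsto (fun k => |a K - c| * Real.exp (S K - S k)) atTop (𝓝 0) := by
    have h1 : Tendsto (fun k => S K - S k) atTop atBot := by
      simpa [sub_eq_add_neg] using
        tendsto_atBot_add_const_left atTop (S K) (tendsto_neg_atTop_atBot.comp hsum)
    simpa using (Real.tendsto_exp_atBot.comp h1).const_mul |a K - c|
  filter_upwards [hlim.eventually_lt_const (sub_pos.2 hcd), eventually_ge_atTop K] with k h1 h2
  linarith [key k h2]

/-- Deterministic asynchronous iteration convergence (Theorem of Appendix B, case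
`ω_{n,k} = 0`): if the coordinates of `y_k` are sandwiched between contracting
iterates driven by `γ‖y_k‖_∞` plus vanishing errors, then `‖y_k‖_∞ → 0`. -/
theorem async_iteration_deterministic {N : Type} [Fintype N] [Nonempty N]
    (γ D : ℝ) (hγ0 : 0 < γ) (hγ1 : γ < 1) (hD : 0 ≤ D)
    (y : ℕ → N → ℝ) (β : N → ℕ → ℝ) (εup εlow : ℕ → ℝ)
    (hybdd : ∀ k, supNorm (y k) ≤ D)
    (hβmem : ∀ n k, β n k ∈ Set.Icc (0:ℝ) 1)
    (hβsum : ∀ n, Tendsto (fun m => ∑ k ∈ Finset.range m, β n k) atTop atTop)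
    (hβ0 : ∀ n, Tendsto (fun k => β n k) atTop (𝓝 0))
    (hεup : Tendsto εup atTop (𝓝 0))
    (hεlow : Tendsto εlow atTop (𝓝 0))
    (hub : ∀ n k, y (k+1) n
      ≤ (1 - β n k) * y k n + β n k * γ * supNorm (y k) + β n k * γ * εup k)
    (hlb : ∀ n k, y (k+1) n
      ≥ (1 - β n k) * y k n - β n k * γ * supNorm (y k) + β n k * γ * εlow k) :
    Tendsto (fun k => supNorm (y k)) atTop (𝓝 0) := by
  have step : ∀ d η : ℝ, 0 < η → (∀ᶠ k in atTop, supNorm (y k) ≤ d) →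
      ∀ᶠ k in atTop, supNorm (y k) ≤ γ * (d + η) + η := by
    intro d η hη hd
    have hcoord : ∀ n, ∀ᶠ k in atTop, |y k n| ≤ γ * (d + η) + η := by
      intro n
      have h1 : ∀ᶠ k in atTop, y k n ≤ γ * (d + η) + η := by
        refine eventually_le_of_relaxation (a := fun k => y k n) (c := γ * (d + η))
          (by linarith) (hβmem n) (hβsum n) ?_
        filter_upwards [hd, hεup.eventually_lt_const hη] with k h2 h3
        have h4 := mul_le_mul_of_nonneg_left (add_le_add h2 h3.le)
          (mul_nonneg (hβmem n k).1 hγ0.le)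
        linarith [hub n k]
      have h2 : ∀ᶠ k in atTop, -y k n ≤ γ * (d + η) + η := by
        refine eventually_le_of_relaxation (a := fun k => -y k n) (c := γ * (d + η))
          (by linarith) (hβmem n) (hβsum n) ?_
        filter_upwards [hd, hεlow.eventually_const_lt (neg_lt_zero.2 hη)] with k h2 h3
        have h4 := mul_le_mul_of_nonneg_left (add_le_add h2 (neg_lt.1 h3).le)
          (mul_nonneg (hβmem n k).1 hγ0.le)
        linarith [hlb n k]
      filter_upwards [h1, h2] with k h3 h4
      exact abs_le'.2 ⟨h3, h4⟩
    filter_upwards [eventually_all.2 hcoord] with k hk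
    exact supNorm_le hk
  set A : Set ℝ := {d | ∀ᶠ k in atTop, supNorm (y k) ≤ d} with hA
  have hAne : A.Nonempty := ⟨D, Eventually.of_forall hybdd⟩
  have hAnonneg : ∀ d ∈ A, 0 ≤ d := by
    intro d hd
    obtain ⟨k, hk⟩ := Eventually.exists hd
    exact (supNorm_nonneg _).trans hk
  have hAbdd : BddBelow A := ⟨0, hAnonneg⟩
  have hinf : sInf A ≤ 0 := by
    by_contra! hpos
    set η := (1 - γ) * sInf A / 4 with hη
    have hηpos : 0 < η := by
      have : 0 < 1 - γ := by linarith
      positivity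
    obtain ⟨d, hdA, hd⟩ := exists_lt_of_csInf_lt hAne (lt_add_of_pos_right (sInf A) hηpos)
    have hle : sInf A ≤ γ * (d + η) + η := csInf_le hAbdd (step d η hηpos hdA)
    have h1 : γ * d < γ * (sInf A + η) := mul_lt_mul_of_pos_left hd hγ0
    have h2 : γ * η < η := mul_lt_of_lt_one_left hηpos hγ1
    linarith
  rw [Metric.tendsto_nhds]
  intro e he
  obtain ⟨d, hdA, hd⟩ := exists_lt_of_csInf_lt hAne (hinf.trans_lt he)
  filter_upwards [show ∀ᶠ k in atTop, supNorm (y k) ≤ d from hdA] with k hk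
  rw [Real.dist_eq, sub_zero, abs_of_nonneg (supNorm_nonneg _)]
  exact hk.trans_lt hd
end
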